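/- arXiv:2303.06104 — 2 statements merged into one kernel-verified Lean document; each statement's English description precedes it below -/
import Mathlib

section
/- Let q ∈ [2, ∞). Then there exists a constant S_q > 0 such that for every antisymmetric u ∈ C_c^∞(ℝ²\{0}; ℂ): ∫_{ℝ²} |∇u(x)|² dx ≥ S_q · ( ∫_{ℝ²} |u(x)|^q / |x|² dx )^{2/q}. (Hardy–Sobolev inequality for antisymmetric functions in two dimensions.) -/
open MeasureTheory

/-- The square of the Euclidean norm on `ℝ²`. -/
noncomputable def sqnorm (x : ℝ × ℝ) : ℝ := x.1 ^ 2 + x.2 ^ 2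

/-- Smooth compactly supported functions on `ℝ²` vanishing in a neighbourhood of `0`. -/
def IsTestFun (u : ℝ × ℝ → ℂ) : Prop :=
  ContDiff ℝ (⊤ : ℕ∞) u ∧ HasCompactSupport u ∧ ∀ᶠ x in nhds (0 : ℝ × ℝ), u x = 0

/-- A function on `ℝ²` is antisymmetric if `u(x₁,x₂) = -u(x₂,x₁)`. -/
def Antisym (u : ℝ × ℝ → ℂ) : Prop := ∀ x : ℝ × ℝ, u (x.2, x.1) = -u x

/-- The Dirichlet energy `∫ |∇u|²` on `ℝ²`. -/
noncomputable def gradEnergy (u : ℝ × ℝ → ℂ) : ℝ :=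
  ∫ x : ℝ × ℝ, (‖fderiv ℝ u x (1, 0)‖ ^ 2 + ‖fderiv ℝ u x (0, 1)‖ ^ 2)

/-- A subspace `M` of antisymmetric test functions on which the quadratic form
`u ↦ ∫ |∇u|² - ∫ V |u|²` is negative for all nonzero `u`. -/
def IsVNegativeAnti (V : ℝ × ℝ → ℝ) (M : Submodule ℂ (ℝ × ℝ → ℂ)) : Prop :=
  (∀ u ∈ M, IsTestFun u ∧ Antisym u) ∧
  ∀ u ∈ M, u ≠ 0 → gradEnergy u < ∫ x : ℝ × ℝ, V x * ‖u x‖ ^ 2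

open scoped ENNReal
open Set

/-- Cauchy–Schwarz inequality for the Lebesgue integral. -/
lemma sq_lintegral_mul_le {α : Type*} [MeasurableSpace α] (μ : Measure α) {f g : α → ℝ≥0∞}
    (hf : AEMeasurable f μ) (hg : AEMeasurable g μ) :
    (∫⁻ a, f a * g a ∂μ) ^ 2 ≤ (∫⁻ a, f a ^ 2 ∂μ) * ∫⁻ a, g a ^ 2 ∂μ := by
  have h := ENNReal.lintegral_mul_le_Lp_mul_Lq μ Real.HolderConjugate.two_two hf hg
  have h2 := pow_le_pow_left' h 2
  have hs : ∀ x : ℝ≥0∞, (x ^ (1 / 2 : ℝ)) ^ 2 = x := fun x => by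
    rw [← ENNReal.rpow_natCast, ← ENNReal.rpow_mul]; norm_num
  rw [mul_pow, hs, hs] at h2
  simpa using h2

/-- The fundamental theorem of calculus for a power of a complex function vanishing at `a`. -/
lemma enorm_pow_succ_le_lintegral {w w' : ℝ → ℂ} (hw : ∀ x, HasDerivAt w (w' x) x)
    (hw' : Continuous w') {a b : ℝ} (ha : w a = 0) (k : ℕ) :
    ‖w b‖ₑ ^ (k + 1) ≤ (k + 1) * ∫⁻ x in uIoc a b, ‖w x‖ₑ ^ k * ‖w' x‖ₑ := by
  have hc : Continuous w := continuous_iff_continuousAt.2 fun x => (hw x).continuousAt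
  have hd : ∀ x, HasDerivAt (fun y => w y ^ (k + 1)) ((k + 1 : ℂ) * w x ^ k * w' x) x := fun x => by
    simpa using (hw x).fun_pow (k + 1)
  have hI := intervalIntegral.integral_eq_sub_of_hasDerivAt (a := a) (b := b)
    (fun x _ => hd x) (Continuous.intervalIntegrable (by fun_prop) _ _)
  simp only [ha, ne_eq, Nat.add_eq_zero_iff, one_ne_zero, and_false, not_false_eq_true, zero_pow,
    sub_zero] at hI
  have hk : ‖(k + 1 : ℂ)‖ₑ = (k + 1 : ℝ≥0∞) := by
    have : ‖((k + 1 : ℕ) : ℂ)‖ₑ = ((k + 1 : ℕ) : ℝ≥0∞) := by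
      rw [← ofReal_norm, Complex.norm_natCast, ENNReal.ofReal_natCast]
    simpa using this
  calc ‖w b‖ₑ ^ (k + 1) = ‖∫ x in a..b, (k + 1 : ℂ) * w x ^ k * w' x‖ₑ := by rw [hI, enorm_pow]
    _ = ‖∫ x in uIoc a b, (k + 1 : ℂ) * w x ^ k * w' x‖ₑ := by
      rw [← ofReal_norm, intervalIntegral.norm_intervalIntegral_eq, ofReal_norm]
    _ ≤ ∫⁻ x in uIoc a b, ‖(k + 1 : ℂ) * w x ^ k * w' x‖ₑ := enorm_integral_le_lintegral_enorm _
    _ = (k + 1) * ∫⁻ x in uIoc a b, ‖w x‖ₑ ^ k * ‖w' x‖ₑ := by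
      rw [← lintegral_const_mul _ (by fun_prop)]
      simp only [enorm_mul, enorm_pow, hk, mul_assoc]

section Product

variable {α β : Type*} [MeasurableSpace α] [MeasurableSpace β] {μ : Measure α} {ν : Measure β}
  [SFinite μ] [SFinite ν] {h D : α × β → ℝ≥0∞}

/-- One step of the Gagliardo–Nirenberg iteration on a product space. -/
lemma lintegral_pow_succ_le (hh : Measurable h) (hD : Measurable D) (k : ℕ)
    (hμ : ∀ᵐ z ∂μ.prod ν, h z ^ (k + 1) ≤ (k + 1) * ∫⁻ r, h (r, z.2) ^ k * D (r, z.2) ∂μ)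
    (hν : ∀ᵐ z ∂μ.prod ν, h z ^ (k + 1) ≤ (k + 1) * ∫⁻ t, h (z.1, t) ^ k * D (z.1, t) ∂ν) :
    ∫⁻ z, h z ^ (2 * (k + 1)) ∂μ.prod ν ≤
      (k + 1) ^ 2 * (∫⁻ z, h z ^ (2 * k) ∂μ.prod ν) * ∫⁻ z, D z ^ 2 ∂μ.prod ν := by
  have hm : Measurable fun z => h z ^ k * D z := by fun_prop
  set A : β → ℝ≥0∞ := fun t => ∫⁻ r, h (r, t) ^ k * D (r, t) ∂μ
  set B : α → ℝ≥0∞ := fun r => ∫⁻ t, h (r, t) ^ k * D (r, t) ∂ν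
  have hAm : Measurable A := hm.lintegral_prod_left'
  have hBm : Measurable B := hm.lintegral_prod_right'
  calc ∫⁻ z, h z ^ (2 * (k + 1)) ∂μ.prod ν
      ≤ ∫⁻ z, (k + 1) * B z.1 * ((k + 1) * A z.2) ∂μ.prod ν := by
        refine lintegral_mono_ae ?_
        filter_upwards [hμ, hν] with z h1 h2
        rw [two_mul, pow_add]
        exact mul_le_mul' h2 h1
    _ = (k + 1) ^ 2 * (∫⁻ z, h z ^ k * D z ∂μ.prod ν) ^ 2 := by
        rw [lintegral_prod_mul (f := fun r => (k + 1) * B r) (g := fun t => (k + 1) * A t)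
          (by fun_prop) (by fun_prop), lintegral_const_mul _ hBm, lintegral_const_mul _ hAm]
        conv_rhs => rw [pow_two (∫⁻ z, h z ^ k * D z ∂μ.prod ν)]
        nth_rewrite 1 [lintegral_prod _ hm.aemeasurable]
        rw [lintegral_prod_symm' _ hm]
        ring
    _ ≤ _ := by
        rw [mul_assoc]
        gcongr
        convert! sq_lintegral_mul_le (μ.prod ν) (hh.pow_const k).aemeasurable hD.aemeasurable
          using 3
        ext z
        rw [← pow_mul, mul_comm]

/-- The Poincaré inequality starting the iteration. -/
lemma lintegral_sq_le (hD : Measurable D)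
    (hν : ∀ᵐ z ∂μ.prod ν, h z ≤ ∫⁻ t, D (z.1, t) ∂ν) :
    ∫⁻ z, h z ^ 2 ∂μ.prod ν ≤ ν univ ^ 2 * ∫⁻ z, D z ^ 2 ∂μ.prod ν := by
  have hDm : Measurable fun z => D z ^ 2 := by fun_prop
  have hBm : Measurable fun r => ∫⁻ t, D (r, t) ^ 2 ∂ν := hDm.lintegral_prod_right'
  calc ∫⁻ z, h z ^ 2 ∂μ.prod ν
      ≤ ∫⁻ z, (ν univ * ∫⁻ t, D (z.1, t) ^ 2 ∂ν) * 1 ∂μ.prod ν := by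
        refine lintegral_mono_ae ?_
        filter_upwards [hν] with z h1
        refine (pow_le_pow_left' h1 2).trans ?_
        have := sq_lintegral_mul_le ν (f := fun _ => 1) (g := fun t => D (z.1, t))
          (by fun_prop) (by fun_prop)
        simpa using this
    _ = _ := by
        rw [lintegral_prod_mul (f := fun r => ν univ * ∫⁻ t, D (r, t) ^ 2 ∂ν) (g := fun _ => 1)
          (by fun_prop) (by fun_prop), lintegral_const_mul _ hBm,
          lintegral_prod _ hDm.aemeasurable]
        simp only [lintegral_const, one_mul]
        ring

/-- All even moments are controlled by the energy. -/
lemma lintegral_pow_le_energy (hh : Measurable h) (hD : Measurable D)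
    (hμ : ∀ k : ℕ, ∀ᵐ z ∂μ.prod ν,
      h z ^ (k + 1) ≤ (k + 1) * ∫⁻ r, h (r, z.2) ^ k * D (r, z.2) ∂μ)
    (hν : ∀ k : ℕ, ∀ᵐ z ∂μ.prod ν,
      h z ^ (k + 1) ≤ (k + 1) * ∫⁻ t, h (z.1, t) ^ k * D (z.1, t) ∂ν) (k : ℕ) :
    ∫⁻ z, h z ^ (2 * (k + 1)) ∂μ.prod ν ≤
      ((k + 1).factorial : ℝ≥0∞) ^ 2 * ν univ ^ 2 * (∫⁻ z, D z ^ 2 ∂μ.prod ν) ^ (k + 1) := by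
  induction k with
  | zero => simpa using lintegral_sq_le hD (by simpa using hν 0)
  | succ k ih =>
    refine (lintegral_pow_succ_le hh hD (k + 1) (hμ _) (hν _)).trans ?_
    refine (mul_le_mul_left (mul_le_mul_right ih _) _).trans_eq ?_
    rw [Nat.factorial_succ (k + 1)]
    push_cast
    ring

end Product

/-- The measure `dr / r` on `(0, ∞)`. -/
noncomputable def radialMeasure : Measure ℝ :=
  (volume.restrict (Ioi 0)).withDensity fun r => ENNReal.ofReal r⁻¹

/-- The measure `dθ` on `(-π, π)`. -/
noncomputable def angularMeasure : Measure ℝ := volume.restrict (Ioo (-Real.pi) Real.pi)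

instance : SFinite radialMeasure := by unfold radialMeasure; infer_instance

instance : SFinite angularMeasure := by unfold angularMeasure; infer_instance

lemma radialMeasure_prod_angularMeasure :
    radialMeasure.prod angularMeasure =
      (volume.restrict polarCoord.target).withDensity fun z => ENNReal.ofReal z.1⁻¹ := by
  rw [radialMeasure, angularMeasure, prod_withDensity_left (by fun_prop), Measure.prod_restrict]
  rfl

lemma ae_radialMeasure_prod_angularMeasure :
    ∀ᵐ z ∂radialMeasure.prod angularMeasure, z ∈ polarCoord.target := by
  rw [radialMeasure_prod_angularMeasure]
  exact (withDensity_absolutelyContinuous _ _).ae_le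
    (ae_restrict_mem polarCoord.open_target.measurableSet)

lemma lintegral_eq_lintegral_polar {F : ℝ × ℝ → ℝ≥0∞} (hF : Measurable F) :
    ∫⁻ x, F x = ∫⁻ z, ENNReal.ofReal (z.1 ^ 2) * F (polarCoord.symm z)
      ∂radialMeasure.prod angularMeasure := by
  have hp : Measurable polarCoord.symm := continuous_polarCoord_symm.measurable
  rw [radialMeasure_prod_angularMeasure, lintegral_withDensity_eq_lintegral_mul _ (by fun_prop)
    (by fun_prop), ← lintegral_comp_polarCoord_symm]
  refine setLIntegral_congr_fun polarCoord.open_target.measurableSet fun z hz => ?_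
  have hz : 0 < z.1 := hz.1
  simp only [Pi.mul_apply, smul_eq_mul]
  rw [← mul_assoc, ← ENNReal.ofReal_mul (by positivity)]
  congr 2
  field_simp

lemma norm_smul_add_smul_le_sqrt {c s : ℝ} (hcs : c ^ 2 + s ^ 2 = 1) (a b : ℂ) :
    ‖c • a + s • b‖ ≤ √(‖a‖ ^ 2 + ‖b‖ ^ 2) := by
  refine Real.le_sqrt_of_sq_le ?_
  have h : ‖c • a + s • b‖ ≤ |c| * ‖a‖ + |s| * ‖b‖ := by
    simpa [norm_smul] using norm_add_le (c • a) (s • b)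
  have h2 := pow_le_pow_left₀ (norm_nonneg _) h 2
  nlinarith [sq_nonneg (|c| * ‖b‖ - |s| * ‖a‖), sq_abs c, sq_abs s]

/-- The norm of the gradient. -/
noncomputable def gradNorm (u : ℝ × ℝ → ℂ) (x : ℝ × ℝ) : ℝ :=
  √(‖fderiv ℝ u x (1, 0)‖ ^ 2 + ‖fderiv ℝ u x (0, 1)‖ ^ 2)

lemma fderiv_apply_pair (u : ℝ × ℝ → ℂ) (x : ℝ × ℝ) (a b : ℝ) :
    fderiv ℝ u x (a, b) = a • fderiv ℝ u x (1, 0) + b • fderiv ℝ u x (0, 1) := by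
  rw [← map_smul, ← map_smul, ← map_add]
  simp

lemma continuous_gradNorm {u : ℝ × ℝ → ℂ} (hu : ContDiff ℝ 1 u) : Continuous (gradNorm u) := by
  have := hu.continuous_fderiv one_ne_zero
  unfold gradNorm
  fun_prop

section Polar

variable {u : ℝ × ℝ → ℂ}

lemma enorm_polar_pow_le_lintegral_radial (hu : ContDiff ℝ 1 u) (h0 : u 0 = 0) (k : ℕ)
    {r : ℝ} (hr : 0 < r) (θ : ℝ) :
    ‖u (polarCoord.symm (r, θ))‖ₑ ^ (k + 1) ≤
      (k + 1) * ∫⁻ s, ‖u (polarCoord.symm (s, θ))‖ₑ ^ k *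
        ENNReal.ofReal (s * gradNorm u (polarCoord.symm (s, θ))) ∂radialMeasure := by
  have hc := hu.continuous
  have hm := hc.measurable
  have hg := continuous_gradNorm hu
  have hf := hu.continuous_fderiv one_ne_zero
  have hd : ∀ s : ℝ, HasDerivAt (fun s => u (s * Real.cos θ, s * Real.sin θ))
      (fderiv ℝ u (s * Real.cos θ, s * Real.sin θ) (Real.cos θ, Real.sin θ)) s := fun s =>
    ((hu.differentiable one_ne_zero _).hasFDerivAt).comp_hasDerivAt s
      ((hasDerivAt_mul_const (Real.cos θ)).prodMk (hasDerivAt_mul_const (Real.sin θ)))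
  have key := enorm_pow_succ_le_lintegral hd (by fun_prop) (a := 0) (b := r)
    (by rw [zero_mul, zero_mul]; exact h0) k
  simp only [polarCoord_symm_apply]
  refine key.trans (mul_le_mul_right ?_ _)
  rw [radialMeasure, lintegral_withDensity_eq_lintegral_mul _ (by fun_prop) (by fun_prop),
    uIoc_of_le hr.le]
  refine (lintegral_mono_set (Ioc_subset_Ioi_self)).trans ?_
  refine setLIntegral_mono (by fun_prop) fun s hs => ?_
  have hs : 0 < s := hs
  simp only [Pi.mul_apply]
  rw [mul_left_comm, ← ENNReal.ofReal_mul (by positivity), inv_mul_cancel_left₀ hs.ne']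
  gcongr
  rw [← ofReal_norm, fderiv_apply_pair]
  exact ENNReal.ofReal_le_ofReal
    (norm_smul_add_smul_le_sqrt (Real.cos_sq_add_sin_sq θ) _ _)

lemma enorm_polar_pow_le_lintegral_angular (hu : ContDiff ℝ 1 u) (ha : Antisym u) (k : ℕ)
    {r : ℝ} (hr : 0 < r) {θ : ℝ} (hθ : θ ∈ Ioo (-Real.pi) Real.pi) :
    ‖u (polarCoord.symm (r, θ))‖ₑ ^ (k + 1) ≤
      (k + 1) * ∫⁻ t, ‖u (polarCoord.symm (r, t))‖ₑ ^ k *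
        ENNReal.ofReal (r * gradNorm u (polarCoord.symm (r, t))) ∂angularMeasure := by
  have hc := hu.continuous
  have hm := hc.measurable
  have hg := continuous_gradNorm hu
  have hf := hu.continuous_fderiv one_ne_zero
  have hd : ∀ t : ℝ, HasDerivAt (fun t => u (r * Real.cos t, r * Real.sin t))
      (fderiv ℝ u (r * Real.cos t, r * Real.sin t) (r * -Real.sin t, r * Real.cos t)) t := fun t =>
    ((hu.differentiable one_ne_zero _).hasFDerivAt).comp_hasDerivAt t
      (((Real.hasDerivAt_cos t).const_mul r).prodMk ((Real.hasDerivAt_sin t).const_mul r))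
  have hzero : u (r * Real.cos (Real.pi / 4), r * Real.sin (Real.pi / 4)) = 0 := by
    have h := ha (r * Real.cos (Real.pi / 4), r * Real.sin (Real.pi / 4))
    simp only [Real.cos_pi_div_four, Real.sin_pi_div_four] at h ⊢
    exact self_eq_neg.1 h
  have key := enorm_pow_succ_le_lintegral hd (by fun_prop) (a := Real.pi / 4) (b := θ) hzero k
  simp only [polarCoord_symm_apply]
  refine key.trans (mul_le_mul_right ?_ _)
  have hpi := Real.pi_pos
  have hsub : uIoc (Real.pi / 4) θ ⊆ Ioo (-Real.pi) Real.pi := by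
    intro t ht
    rw [mem_uIoc] at ht
    constructor <;> rcases ht with ht | ht <;> linarith [ht.1, ht.2, hθ.1, hθ.2]
  refine (lintegral_mono_set hsub).trans ?_
  refine setLIntegral_mono (by fun_prop) fun t _ => ?_
  gcongr
  rw [← ofReal_norm, fderiv_apply_pair, mul_smul, mul_smul, ← smul_add, norm_smul,
    Real.norm_of_nonneg hr.le]
  refine ENNReal.ofReal_le_ofReal (mul_le_mul_of_nonneg_left ?_ hr.le)
  exact norm_smul_add_smul_le_sqrt (by rw [neg_sq, Real.sin_sq_add_cos_sq]) _ _

lemma lintegral_enorm_pow_div_sqnorm_le (hu : ContDiff ℝ 1 u) (h0 : u 0 = 0) (ha : Antisym u)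
    (k : ℕ) :
    ∫⁻ x, ‖u x‖ₑ ^ (2 * (k + 1)) * ENNReal.ofReal (sqnorm x)⁻¹ ≤
      ((k + 1).factorial : ℝ≥0∞) ^ 2 * angularMeasure univ ^ 2 *
        (∫⁻ x, ENNReal.ofReal (gradNorm u x ^ 2)) ^ (k + 1) := by
  have hc := hu.continuous
  have hg := continuous_gradNorm hu
  have hp := continuous_polarCoord_symm
  have hs : Continuous sqnorm := by unfold sqnorm; fun_prop
  have hmem := ae_radialMeasure_prod_angularMeasure
  have key := lintegral_pow_le_energy (μ := radialMeasure) (ν := angularMeasure)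
    (h := fun z => ‖u (polarCoord.symm z)‖ₑ)
    (D := fun z => ENNReal.ofReal (z.1 * gradNorm u (polarCoord.symm z)))
    (hc.comp hp).enorm.measurable (by fun_prop)
    (fun k => hmem.mono fun z hz => enorm_polar_pow_le_lintegral_radial hu h0 k hz.1 z.2)
    (fun k => hmem.mono fun z hz => enorm_polar_pow_le_lintegral_angular hu ha k hz.1 hz.2) k
  rw [lintegral_eq_lintegral_polar (by fun_prop), lintegral_eq_lintegral_polar (by fun_prop)]
  convert! key using 1
  · refine lintegral_congr_ae (hmem.mono fun z hz => ?_)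
    have hz : 0 < z.1 := hz.1
    have : sqnorm (polarCoord.symm z) = z.1 ^ 2 := by
      simp only [polarCoord_symm_apply, sqnorm]
      linear_combination z.1 ^ 2 * Real.cos_sq_add_sin_sq z.2
    simp only [this]
    rw [mul_left_comm, ← ENNReal.ofReal_mul (by positivity), mul_inv_cancel₀ (by positivity)]
    simp
  · congr 2
    refine lintegral_congr_ae (hmem.mono fun z hz => ?_)
    have hz : 0 < z.1 := hz.1
    have : 0 ≤ gradNorm u (polarCoord.symm z) := Real.sqrt_nonneg _
    simp only
    rw [← ENNReal.ofReal_mul (by positivity), ← ENNReal.ofReal_pow (by positivity), mul_pow]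

end Polar

lemma rpow_le_sq_add_pow {q : ℝ} (hq : 2 ≤ q) {n : ℕ} (hn : q ≤ 2 * (n : ℝ)) {a : ℝ}
    (ha : 0 ≤ a) : a ^ q ≤ a ^ 2 + a ^ (2 * n) := by
  rcases le_total a 1 with h | h
  · have h1 : a ^ q ≤ a ^ (2 : ℝ) := Real.rpow_le_rpow_of_exponent_ge_of_imp ha h hq
      (fun _ h => by linarith)
    rw [Real.rpow_two] at h1
    linarith [pow_nonneg ha (2 * n)]
  · have h1 : a ^ q ≤ a ^ (((2 * n : ℕ)) : ℝ) :=
      Real.rpow_le_rpow_of_exponent_le h (by push_cast; exact hn)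
    rw [Real.rpow_natCast] at h1
    linarith [pow_nonneg ha 2]

/-- The scaled form of `rpow_le_sq_add_pow`. -/
lemma rpow_le_mul_sq_add_mul_pow {q : ℝ} (hq : 2 ≤ q) {n : ℕ} (hn : q ≤ 2 * (n : ℝ)) {a E : ℝ}
    (ha : 0 ≤ a) (hE : 0 < E) :
    a ^ q ≤ E ^ (q / 2) * (E⁻¹ * a ^ 2 + (E ^ n)⁻¹ * a ^ (2 * n)) := by
  have h := rpow_le_sq_add_pow hq hn (div_nonneg ha (Real.sqrt_nonneg E))
  rw [Real.div_rpow ha (Real.sqrt_nonneg E), div_le_iff₀ (by positivity), div_pow, div_pow,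
    pow_mul √E, Real.sq_sqrt hE.le, Real.sqrt_eq_rpow, ← Real.rpow_mul hE.le] at h
  refine h.trans_eq ?_
  rw [show 1 / 2 * q = q / 2 by ring]
  ring

lemma IsTestFun.lintegral_gradNorm_sq {u : ℝ × ℝ → ℂ} (hu : IsTestFun u) :
    ∫⁻ x, ENNReal.ofReal (gradNorm u x ^ 2) = ENNReal.ofReal (gradEnergy u) := by
  have hf := hu.1.continuous_fderiv (by simp)
  have hs : ∀ x, gradNorm u x ^ 2 =
      ‖fderiv ℝ u x (1, 0)‖ ^ 2 + ‖fderiv ℝ u x (0, 1)‖ ^ 2 := fun x =>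
    Real.sq_sqrt (by positivity)
  have hsupp : HasCompactSupport fun x =>
      ‖fderiv ℝ u x (1, 0)‖ ^ 2 + ‖fderiv ℝ u x (0, 1)‖ ^ 2 :=
    (hu.2.1.fderiv ℝ).mono fun x hx hx0 => hx (by simp [hx0])
  simp only [hs]
  rw [gradEnergy, ofReal_integral_eq_lintegral_ofReal
    (Continuous.integrable_of_hasCompactSupport (by fun_prop) hsupp)
    (Filter.Eventually.of_forall fun x => by positivity)]

lemma angularMeasure_univ : angularMeasure univ = ENNReal.ofReal (2 * Real.pi) := by
  rw [angularMeasure, Measure.restrict_apply_univ, Real.volume_Ioo]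
  ring_nf

lemma IsTestFun.integral_rpow_div_sqnorm_le {u : ℝ × ℝ → ℂ} (hu : IsTestFun u) (ha : Antisym u)
    {q : ℝ} (hq : 2 ≤ q) {k : ℕ} (hk : q ≤ 2 * ((k + 1 : ℕ) : ℝ)) {E : ℝ} (hE : 0 < E)
    (hle : gradEnergy u ≤ E) :
    ∫ x, ‖u x‖ ^ q / sqnorm x ≤
      E ^ (q / 2) * ((2 * Real.pi) ^ 2 + (k + 1).factorial ^ 2 * (2 * Real.pi) ^ 2) := by
  have hc := hu.1.continuous
  have hs : Continuous sqnorm := by unfold sqnorm; fun_prop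
  have hs0 : ∀ x, 0 ≤ sqnorm x := fun x => by unfold sqnorm; positivity
  have hpi := Real.pi_pos
  have hbound : ∀ j : ℕ, ∫⁻ x, ‖u x‖ₑ ^ (2 * (j + 1)) * ENNReal.ofReal (sqnorm x)⁻¹ ≤
      ENNReal.ofReal ((j + 1).factorial ^ 2 * (2 * Real.pi) ^ 2 * E ^ (j + 1)) := fun j => by
    refine (lintegral_enorm_pow_div_sqnorm_le (hu.1.of_le (by simp)) hu.2.2.self_of_nhds
      ha j).trans ?_
    rw [hu.lintegral_gradNorm_sq, angularMeasure_univ,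
      ENNReal.ofReal_mul (p := (j + 1).factorial ^ 2 * (2 * Real.pi) ^ 2) (by positivity),
      ENNReal.ofReal_mul (p := (j + 1).factorial ^ 2) (by positivity), ENNReal.ofReal_pow (by positivity),
      ENNReal.ofReal_pow (by positivity), ENNReal.ofReal_pow (by positivity),
      ENNReal.ofReal_natCast]
    gcongr
  have hpt : ∀ x, ENNReal.ofReal (‖u x‖ ^ q / sqnorm x) ≤
      ENNReal.ofReal (E ^ (q / 2) * E⁻¹) *
        (‖u x‖ₑ ^ (2 * (0 + 1)) * ENNReal.ofReal (sqnorm x)⁻¹) +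
      ENNReal.ofReal (E ^ (q / 2) * (E ^ (k + 1))⁻¹) *
        (‖u x‖ₑ ^ (2 * (k + 1)) * ENNReal.ofReal (sqnorm x)⁻¹) := fun x => by
    have hi := inv_nonneg.2 (hs0 x)
    rw [← ofReal_norm, ← ENNReal.ofReal_pow (norm_nonneg _), ← ENNReal.ofReal_pow (norm_nonneg _),
      ← ENNReal.ofReal_mul (by positivity), ← ENNReal.ofReal_mul (by positivity),
      ← ENNReal.ofReal_mul (by positivity), ← ENNReal.ofReal_mul (by positivity),
      ← ENNReal.ofReal_add (by positivity) (by positivity)]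
    refine ENNReal.ofReal_le_ofReal ?_
    rw [div_eq_mul_inv]
    refine (mul_le_mul_of_nonneg_right
      (rpow_le_mul_sq_add_mul_pow hq hk (norm_nonneg (u x)) hE) hi).trans_eq ?_
    ring
  rw [integral_eq_lintegral_of_nonneg_ae
    (Filter.Eventually.of_forall fun x => div_nonneg (by positivity) (hs0 x))
    (by fun_prop : Measurable fun x => ‖u x‖ ^ q / sqnorm x).aestronglyMeasurable]
  refine ENNReal.toReal_le_of_le_ofReal (by positivity) ?_
  refine (lintegral_mono hpt).trans ?_
  rw [lintegral_add_left (by fun_prop), lintegral_const_mul _ (by fun_prop),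
    lintegral_const_mul _ (by fun_prop)]
  refine (add_le_add (mul_le_mul_right (hbound 0) _) (mul_le_mul_right (hbound k) _)).trans_eq ?_
  rw [← ENNReal.ofReal_mul (by positivity), ← ENNReal.ofReal_mul (by positivity),
    ← ENNReal.ofReal_add (by positivity) (by positivity)]
  congr 1
  simp only [zero_add, Nat.factorial_one, Nat.cast_one, pow_one, one_pow, one_mul]
  field_simp

theorem HardySobolev_antisymmetric (q : ℝ) (hq : 2 ≤ q) :
    ∃ S : ℝ, 0 < S ∧
      ∀ u : ℝ × ℝ → ℂ, IsTestFun u → Antisym u →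
        S * (∫ x : ℝ × ℝ, ‖u x‖ ^ q / sqnorm x) ^ (2 / q) ≤ gradEnergy u := by
  obtain ⟨k, hk⟩ := exists_nat_ge q
  have hk : q ≤ 2 * ((k + 1 : ℕ) : ℝ) := by push_cast; linarith
  have hpi := Real.pi_pos
  set C : ℝ := (2 * Real.pi) ^ 2 + (k + 1).factorial ^ 2 * (2 * Real.pi) ^ 2
  have hC0 : 0 < C := by positivity
  refine ⟨(C ^ (2 / q))⁻¹, by positivity, fun u hu ha => le_of_forall_gt_imp_ge_of_dense ?_⟩
  intro E hE
  have hE0 : 0 < E := lt_of_le_of_lt (integral_nonneg fun x => by positivity) hE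
  have h0 : 0 ≤ ∫ x : ℝ × ℝ, ‖u x‖ ^ q / sqnorm x :=
    integral_nonneg fun x => by unfold sqnorm; positivity
  have h := Real.rpow_le_rpow h0 (hu.integral_rpow_div_sqnorm_le ha hq hk hE0 hE.le)
    (by positivity : 0 ≤ 2 / q)
  rw [Real.mul_rpow (by positivity) hC0.le, ← Real.rpow_mul hE0.le,
    show q / 2 * (2 / q) = 1 by field_simp, Real.rpow_one] at h
  rw [inv_mul_le_iff₀ (by positivity), mul_comm]
  exact h
end

section
/- For every q ∈ [2, ∞) there is a constant K_q < ∞ such that for every Φ ∈ ℝ \ ℤ the following holds: if S ≥ 0 is such that ∫_{ℝ²} |D_Φ u|² dx ≥ S ( ∫_{ℝ²} |u|^q/|x|² dx )^{2/q} for all u ∈ C_c^∞(ℝ²\{0}; ℂ), then S ≤ K_q · d(Φ)^{1+2/q}. (Optimal-order upper bound on the magnetic Hardy–Sobolev constant, proved by testing on u(r cos θ, r sin θ) = φ((ln r)/ℓ) e^{inθ} with d(Φ) = |n − Φ| and ℓ = d(Φ)^{−1}.) -/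
open MeasureTheory

/-- The magnetic energy `∫ |D_Φ u|²` for the Aharonov–Bohm vector potential
`A(x) = |x|⁻² (x₂, -x₁)`, where `D_Φ u = -i∇u + Φ A u`. -/
noncomputable def magEnergy (Φ : ℝ) (u : ℝ × ℝ → ℂ) : ℝ :=
  ∫ x : ℝ × ℝ,
    (‖-Complex.I * fderiv ℝ u x (1, 0) + ((Φ * (x.2 / sqnorm x) : ℝ) : ℂ) * u x‖ ^ 2 +
     ‖-Complex.I * fderiv ℝ u x (0, 1) + ((Φ * (-x.1 / sqnorm x) : ℝ) : ℂ) * u x‖ ^ 2)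

/-- A subspace `M` of test functions is `V`-negative for `D_Φ` if
every nonzero `u ∈ M` satisfies `∫ |D_Φ u|² < ∫ V |u|²`. -/
def IsVNegative (Φ : ℝ) (V : ℝ × ℝ → ℝ) (M : Submodule ℂ (ℝ × ℝ → ℂ)) : Prop :=
  (∀ u ∈ M, IsTestFun u) ∧
  ∀ u ∈ M, u ≠ 0 → magEnergy Φ u < ∫ x : ℝ × ℝ, V x * ‖u x‖ ^ 2

/-- The distance `d(Φ) = min_{k ∈ ℤ} |Φ - k|` of a real number to the integers. -/
noncomputable def distToInt (Φ : ℝ) : ℝ := |Φ - round Φ|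

/-- The vortex `φ(d log |x|) e^{inθ}` on the punctured plane, extended by `0` to the origin. -/
noncomputable def vortex (φ : ℝ → ℝ) (d : ℝ) (n : ℤ) (x : ℝ × ℝ) : ℂ :=
  if x = 0 then 0 else
    ((x.1 : ℂ) + x.2 * Complex.I) ^ n *
      ((φ (d / 2 * Real.log (sqnorm x)) *
        Real.exp (-(n / 2) * Real.log (sqnorm x)) : ℝ) : ℂ)

theorem sqnorm_pos {x : ℝ × ℝ} (hx : x ≠ 0) : 0 < sqnorm x := by
  unfold sqnorm
  by_contra! h
  apply hx
  ext
  · simp only [Prod.fst_zero]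
    nlinarith [sq_nonneg x.1, sq_nonneg x.2]
  · simp only [Prod.snd_zero]
    nlinarith [sq_nonneg x.1, sq_nonneg x.2]

theorem continuous_sqnorm : Continuous sqnorm := by
  unfold sqnorm
  fun_prop

theorem norm_sq_le_sqnorm (x : ℝ × ℝ) : ‖x‖ ^ 2 ≤ sqnorm x := by
  unfold sqnorm
  rw [Prod.norm_def]
  rcases max_choice ‖x.1‖ ‖x.2‖ with h | h <;> rw [h, Real.norm_eq_abs, sq_abs] <;>
    nlinarith [sq_nonneg x.1, sq_nonneg x.2]

theorem complex_coord_ne_zero {x : ℝ × ℝ} (hx : x ≠ 0) : (x.1 : ℂ) + x.2 * Complex.I ≠ 0 := by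
  intro h
  apply hx
  ext
  · simpa using congrArg Complex.re h
  · simpa using congrArg Complex.im h

theorem norm_vortex_phase {x : ℝ × ℝ} (hx : x ≠ 0) (n : ℤ) :
    ‖((x.1 : ℂ) + x.2 * Complex.I) ^ n‖ * Real.exp (-(n / 2) * Real.log (sqnorm x)) = 1 := by
  have hs : sqnorm x = ‖(x.1 : ℂ) + x.2 * Complex.I‖ ^ 2 := by
    rw [Complex.sq_norm, Complex.normSq_add_mul_I, sqnorm]
  have hpos : 0 < ‖(x.1 : ℂ) + x.2 * Complex.I‖ := norm_pos_iff.mpr (complex_coord_ne_zero hx)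
  rw [hs, norm_zpow, Real.log_pow, ← Real.rpow_intCast, Real.rpow_def_of_pos hpos,
    ← Real.exp_add, Real.exp_eq_one_iff]
  push_cast
  ring

theorem norm_vortex {φ : ℝ → ℝ} (hφ : ∀ t, 0 ≤ φ t) (d : ℝ) (n : ℤ) {x : ℝ × ℝ} (hx : x ≠ 0) :
    ‖vortex φ d n x‖ = φ (d / 2 * Real.log (sqnorm x)) := by
  rw [vortex, if_neg hx, norm_mul, Complex.norm_real, Real.norm_eq_abs,
    abs_of_nonneg (mul_nonneg (hφ _) (Real.exp_pos _).le)]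
  linear_combination φ (d / 2 * Real.log (sqnorm x)) * norm_vortex_phase hx n

theorem vortex_eventuallyEq (φ : ℝ → ℝ) (d : ℝ) (n : ℤ) {x : ℝ × ℝ} (hx : x ≠ 0) :
    vortex φ d n =ᶠ[nhds x] fun y => ((y.1 : ℂ) + y.2 * Complex.I) ^ n *
      ((φ (d / 2 * Real.log (sqnorm y)) *
        Real.exp (-(n / 2) * Real.log (sqnorm y)) : ℝ) : ℂ) := by
  filter_upwards [isOpen_ne.mem_nhds hx] with y hy
  exact if_neg hy

theorem vortex_eq_zero {φ : ℝ → ℝ} {R : ℝ} (hR : ∀ t, R ≤ |t| → φ t = 0) {d : ℝ} {n : ℤ}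
    {x : ℝ × ℝ} (h : R ≤ |d / 2 * Real.log (sqnorm x)|) : vortex φ d n x = 0 := by
  simp [vortex, hR _ h]

theorem isTestFun_vortex {φ : ℝ → ℝ} (hφ : ContDiff ℝ (⊤ : ℕ∞) φ) {R : ℝ}
    (hR : ∀ t, R ≤ |t| → φ t = 0) {d : ℝ} (hd : 0 < d) (n : ℤ) : IsTestFun (vortex φ d n) := by
  have hzero : ∀ᶠ x in nhds (0 : ℝ × ℝ), vortex φ d n x = 0 := by
    have hs : ∀ᶠ x in nhds (0 : ℝ × ℝ), sqnorm x < Real.exp (-(2 * R / d)) :=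
      continuous_sqnorm.continuousAt.eventually_lt_const
        (by simpa [sqnorm] using Real.exp_pos _)
    filter_upwards [hs] with x hx
    by_cases hx0 : x = 0
    · simp [vortex, hx0]
    · apply vortex_eq_zero hR
      have hlog := (Real.log_lt_iff_lt_exp (sqnorm_pos hx0)).mpr hx
      have := mul_lt_mul_of_pos_left hlog (half_pos hd)
      have h2 : d / 2 * -(2 * R / d) = -R := by field_simp
      exact le_trans (by linarith) (neg_le_abs _)
  refine ⟨contDiff_iff_contDiffAt.mpr fun x => ?_, ?_, hzero⟩
  · by_cases hx : x = 0
    · subst hx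
      exact contDiffAt_const.congr_of_eventuallyEq hzero
    · refine ContDiffAt.congr_of_eventuallyEq ?_ (vortex_eventuallyEq φ d n hx)
      have hs := (sqnorm_pos hx).ne'
      have hlog : ContDiffAt ℝ (⊤ : ℕ∞) (fun y : ℝ × ℝ => Real.log (sqnorm y)) x := by
        refine ContDiffAt.log ?_ hs
        unfold sqnorm
        fun_prop
      have hz : ContDiffAt ℝ (⊤ : ℕ∞)
          (fun y : ℝ × ℝ => (y.1 : ℂ) + y.2 * Complex.I) x := by
        have h1 : ContDiff ℝ (⊤ : ℕ∞) (fun y : ℝ × ℝ => (y.1 : ℂ)) :=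
          Complex.ofRealCLM.contDiff.comp contDiff_fst
        have h2 : ContDiff ℝ (⊤ : ℕ∞) (fun y : ℝ × ℝ => (y.2 : ℂ)) :=
          Complex.ofRealCLM.contDiff.comp contDiff_snd
        exact (h1.add (h2.mul contDiff_const)).contDiffAt
      have hpow : ContDiffAt ℝ (⊤ : ℕ∞) (fun z : ℂ => z ^ n)
          ((x.1 : ℂ) + x.2 * Complex.I) :=
        ((analyticAt_id.zpow (complex_coord_ne_zero hx)).contDiffAt (𝕜 := ℂ)).restrict_scalars ℝ
      refine (hpow.comp x hz).mul (Complex.ofRealCLM.contDiff.contDiffAt.comp x ?_)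
      exact (hφ.contDiffAt.comp x (contDiffAt_const.mul hlog)).mul
        (contDiffAt_const.mul hlog).exp
  · refine HasCompactSupport.intro (isCompact_closedBall (0 : ℝ × ℝ) (Real.exp (R / d)))
      fun x hx => vortex_eq_zero hR ?_
    rw [Metric.mem_closedBall, dist_zero_right, not_le] at hx
    have hx2 : Real.exp (2 * R / d) < sqnorm x := by
      refine lt_of_lt_of_le ?_ (norm_sq_le_sqnorm x)
      have : Real.exp (2 * R / d) = Real.exp (R / d) ^ 2 := by
        rw [← Real.exp_nat_mul]
        push_cast
        ring_nf
      rw [this]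
      gcongr
    have hlog := (Real.lt_log_iff_exp_lt ((Real.exp_pos _).trans hx2)).mpr hx2
    have := mul_lt_mul_of_pos_left hlog (half_pos hd)
    have h2 : d / 2 * (2 * R / d) = R := by field_simp
    exact le_trans (by linarith) (le_abs_self _)

theorem hasFDerivAt_complex_coord (x : ℝ × ℝ) :
    HasFDerivAt (fun y : ℝ × ℝ => (y.1 : ℂ) + y.2 * Complex.I)
      (Complex.equivRealProdCLM.symm : ℝ × ℝ →L[ℝ] ℂ) x := by
  have h := (Complex.equivRealProdCLM.symm : ℝ × ℝ →L[ℝ] ℂ).hasFDerivAt (x := x)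
  refine h.congr_of_eventuallyEq (Filter.Eventually.of_forall fun y => ?_)
  simp [Complex.equivRealProdCLM_symm_apply]

theorem fderiv_vortex {φ : ℝ → ℝ} (hφ : Differentiable ℝ φ) (d : ℝ) (n : ℤ) {x : ℝ × ℝ}
    (hx : x ≠ 0) (v : ℝ × ℝ) :
    fderiv ℝ (vortex φ d n) x v =
      ((x.1 : ℂ) + x.2 * Complex.I) ^ n *
        (Real.exp (-(n / 2) * Real.log (sqnorm x)) : ℂ) / (sqnorm x : ℂ) *
      (d * (deriv φ (d / 2 * Real.log (sqnorm x)) : ℝ) * (x.1 * v.1 + x.2 * v.2) +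
        Complex.I * n * (φ (d / 2 * Real.log (sqnorm x)) : ℝ) *
          (x.1 * v.2 - x.2 * v.1)) := by
  have hs := (sqnorm_pos hx).ne'
  have hz := complex_coord_ne_zero hx
  rw [(vortex_eventuallyEq φ d n hx).fderiv_eq]
  have hsq : HasFDerivAt sqnorm
      ((2 * x.1) • ContinuousLinearMap.fst ℝ ℝ ℝ + (2 * x.2) • ContinuousLinearMap.snd ℝ ℝ ℝ)
      x := by
    have h := ((hasFDerivAt_fst (𝕜 := ℝ) (p := x)).pow 2).add
      ((hasFDerivAt_snd (𝕜 := ℝ) (p := x)).pow 2)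
    refine h.congr_fderiv ?_
    ext <;> simp
  have hlog := hsq.log hs
  have hrad := ((hφ _).hasDerivAt.comp_hasFDerivAt x (hlog.const_mul (d / 2))).mul
    (hlog.const_mul (-(n / 2 : ℝ))).exp
  have hpow := ((hasDerivAt_zpow n _ (Or.inl hz)).hasFDerivAt.restrictScalars ℝ).comp x
    (hasFDerivAt_complex_coord x)
  have h := hpow.mul (Complex.ofRealCLM.hasFDerivAt.comp x hrad)
  have hsC : (sqnorm x : ℂ) = (x.1 + x.2 * Complex.I) * (x.1 - x.2 * Complex.I) := by
    simp only [sqnorm]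
    push_cast
    linear_combination (x.2 : ℂ) ^ 2 * Complex.I_sq
  have hsC0 : (sqnorm x : ℂ) ≠ 0 := by exact_mod_cast hs
  refine (congrArg (fun L => L v) h.fderiv).trans ?_
  simp [Complex.equivRealProdCLM_symm_apply, zpow_sub_one₀ hz]
  generalize φ (d / 2 * Real.log (sqnorm x)) = b
  field_simp
  rw [hsC]
  linear_combination (-(n * b * v.2 * x.2 * (x.1 + x.2 * Complex.I)) : ℂ) * Complex.I_sq

theorem vortex_energy_density {φ : ℝ → ℝ} (hφ : Differentiable ℝ φ) (Φ : ℝ) (n : ℤ) {d : ℝ}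
    (hd : (Φ - n) ^ 2 = d ^ 2) {x : ℝ × ℝ} (hx : x ≠ 0) :
    ‖-Complex.I * fderiv ℝ (vortex φ d n) x (1, 0) +
        ((Φ * (x.2 / sqnorm x) : ℝ) : ℂ) * vortex φ d n x‖ ^ 2 +
      ‖-Complex.I * fderiv ℝ (vortex φ d n) x (0, 1) +
        ((Φ * (-x.1 / sqnorm x) : ℝ) : ℂ) * vortex φ d n x‖ ^ 2 =
    d ^ 2 * (deriv φ (d / 2 * Real.log (sqnorm x)) ^ 2 +
      φ (d / 2 * Real.log (sqnorm x)) ^ 2) / sqnorm x := by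
  have hs := (sqnorm_pos hx).ne'
  have hsC0 : (sqnorm x : ℂ) ≠ 0 := by exact_mod_cast hs
  have hphase := norm_vortex_phase hx n
  rw [fderiv_vortex hφ d n hx, fderiv_vortex hφ d n hx, vortex, if_neg hx]
  set a := deriv φ (d / 2 * Real.log (sqnorm x))
  set b := φ (d / 2 * Real.log (sqnorm x))
  set E := Real.exp (-(n / 2) * Real.log (sqnorm x))
  set Z := ((x.1 : ℂ) + x.2 * Complex.I) ^ n
  have hw : ‖Z * (E : ℂ)‖ = 1 := by
    rw [norm_mul, Complex.norm_real, Real.norm_eq_abs, abs_of_pos (Real.exp_pos _), hphase]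
  have hnorm (p r : ℝ) : ‖Z * (E : ℂ) * ((p : ℂ) + r * Complex.I)‖ ^ 2 = p ^ 2 + r ^ 2 := by
    rw [norm_mul, hw, one_mul, Complex.sq_norm, Complex.normSq_add_mul_I]
  have h1 : -Complex.I * (Z * E / (sqnorm x : ℂ) *
      (d * a * (x.1 * ((1 : ℝ) : ℂ) + x.2 * ((0 : ℝ) : ℂ)) + Complex.I * n * b * (x.1 * ((0 : ℝ) : ℂ) - x.2 * ((1 : ℝ) : ℂ)))) +
      ((Φ * (x.2 / sqnorm x) : ℝ) : ℂ) * (Z * ((b * E : ℝ) : ℂ)) =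
      Z * E * ((((Φ - n) * b * x.2 / sqnorm x : ℝ) : ℂ) +
        ((-(d * a * x.1 / sqnorm x) : ℝ) : ℂ) * Complex.I) := by
    push_cast
    field_simp
    linear_combination (Z * E * n * b * x.2 : ℂ) * Complex.I_sq
  have h2 : -Complex.I * (Z * E / (sqnorm x : ℂ) *
      (d * a * (x.1 * ((0 : ℝ) : ℂ) + x.2 * ((1 : ℝ) : ℂ)) + Complex.I * n * b * (x.1 * ((1 : ℝ) : ℂ) - x.2 * ((0 : ℝ) : ℂ)))) +
      ((Φ * (-x.1 / sqnorm x) : ℝ) : ℂ) * (Z * ((b * E : ℝ) : ℂ)) =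
      Z * E * (((-((Φ - n) * b * x.1 / sqnorm x) : ℝ) : ℂ) +
        ((-(d * a * x.2 / sqnorm x) : ℝ) : ℂ) * Complex.I) := by
    push_cast
    field_simp
    linear_combination (-Z * E * n * b * x.1 : ℂ) * Complex.I_sq
  rw [h1, h2, hnorm, hnorm]
  have hsx : x.1 ^ 2 + x.2 ^ 2 = sqnorm x := rfl
  field_simp
  rw [← hsx]
  linear_combination (b ^ 2 * (x.1 ^ 2 + x.2 ^ 2)) * hd

theorem integral_comp_log_sqnorm_div (G : ℝ → ℝ) {d : ℝ} (hd : 0 < d) :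
    ∫ x : ℝ × ℝ, G (d / 2 * Real.log (sqnorm x)) / sqnorm x =
      2 * Real.pi / d * ∫ t, G t := by
  have hpolar : ∀ p ∈ polarCoord.target,
      p.1 • (G (d / 2 * Real.log (sqnorm (polarCoord.symm p))) / sqnorm (polarCoord.symm p)) =
        G (d * Real.log p.1) / p.1 * 1 := by
    intro p hp
    have hp0 : 0 < p.1 := hp.1
    have hs : sqnorm (polarCoord.symm p) = p.1 ^ 2 := by
      simp only [sqnorm, polarCoord_symm_apply]
      linear_combination p.1 ^ 2 * Real.sin_sq_add_cos_sq p.2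
    rw [hs, Real.log_pow, smul_eq_mul]
    push_cast
    rw [show d / 2 * (2 * Real.log p.1) = d * Real.log p.1 by ring]
    field_simp
  have hexp : ∫ r in Set.Ioi (0 : ℝ), G (d * Real.log r) / r = d⁻¹ * ∫ t, G t := by
    have himage : (fun t : ℝ => Real.exp (t / d)) '' Set.univ = Set.Ioi 0 := by
      ext r
      simp only [Set.image_univ, Set.mem_range, Set.mem_Ioi]
      refine ⟨fun ⟨t, ht⟩ => ht ▸ Real.exp_pos _, fun hr => ⟨d * Real.log r, ?_⟩⟩
      rw [mul_div_cancel_left₀ _ hd.ne', Real.exp_log hr]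
    rw [← himage, integral_image_eq_integral_abs_deriv_smul MeasurableSet.univ
      (fun t _ => ((hasDerivAt_id' t).div_const d).exp.hasDerivWithinAt)
      (fun s _ t _ h => by
        have := Real.exp_injective h
        field_simp at this
        exact this), setIntegral_univ, ← integral_const_mul]
    congr 1 with t
    have he := Real.exp_pos (t / d)
    simp only [smul_eq_mul, Real.log_exp]
    rw [mul_div_cancel₀ _ hd.ne', abs_of_pos (by positivity)]
    field_simp
  rw [← integral_comp_polarCoord_symm,
    setIntegral_congr_fun polarCoord.open_target.measurableSet hpolar, polarCoord_target,
    Measure.volume_eq_prod,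
    setIntegral_prod_mul (fun r : ℝ => G (d * Real.log r) / r) (fun _ : ℝ => (1 : ℝ)), hexp]
  simp [Real.pi_pos.le]
  ring

theorem magEnergy_vortex {φ : ℝ → ℝ} (hφ : Differentiable ℝ φ) (Φ : ℝ) (n : ℤ) {d : ℝ}
    (hd0 : 0 < d) (hd : (Φ - n) ^ 2 = d ^ 2) :
    magEnergy Φ (vortex φ d n) = 2 * Real.pi * d * ∫ t, (deriv φ t ^ 2 + φ t ^ 2) := by
  have hae : ∀ᵐ x : ℝ × ℝ, x ≠ 0 := Measure.ae_ne volume 0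
  rw [magEnergy, integral_congr_ae (hae.mono fun x hx => vortex_energy_density hφ Φ n hd hx),
    integral_comp_log_sqnorm_div (fun t => d ^ 2 * (deriv φ t ^ 2 + φ t ^ 2)) hd0,
    integral_const_mul]
  field_simp

theorem integral_norm_vortex_rpow {φ : ℝ → ℝ} (hφ : ∀ t, 0 ≤ φ t) {d : ℝ} (hd : 0 < d) (n : ℤ)
    (q : ℝ) :
    ∫ x : ℝ × ℝ, ‖vortex φ d n x‖ ^ q / sqnorm x = 2 * Real.pi / d * ∫ t, φ t ^ q := by
  have hae : ∀ᵐ x : ℝ × ℝ, x ≠ 0 := Measure.ae_ne volume 0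
  rw [← integral_comp_log_sqnorm_div (fun t => φ t ^ q) hd]
  refine integral_congr_ae (hae.mono fun x hx => ?_)
  simp only [norm_vortex hφ d n hx]

theorem magnetic_HardySobolev_constant_upper_bound (q : ℝ) (hq : 2 ≤ q) :
    ∃ K : ℝ, 0 ≤ K ∧
      ∀ Φ : ℝ, (∀ k : ℤ, Φ ≠ k) →
      ∀ S : ℝ, 0 ≤ S →
        (∀ u : ℝ × ℝ → ℂ, IsTestFun u →
          S * (∫ x : ℝ × ℝ, ‖u x‖ ^ q / sqnorm x) ^ (2 / q) ≤ magEnergy Φ u) →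
        S ≤ K * distToInt Φ ^ (1 + 2 / q) := by
  have hq0 : 0 < q := by linarith
  let φ : ContDiffBump (0 : ℝ) := ⟨1, 2, one_pos, one_lt_two⟩
  have hφ : ContDiff ℝ (⊤ : ℕ∞) φ := φ.contDiff
  have hnonneg (t : ℝ) : 0 ≤ φ t := φ.nonneg
  have hsupp (t : ℝ) (ht : 2 ≤ |t|) : φ t = 0 :=
    φ.zero_of_le_dist (by simpa using ht)
  have hcq : 0 < ∫ t, φ t ^ q := by
    refine Continuous.integral_pos_of_hasCompactSupport_nonneg_nonzero (x := 0)
      (φ.continuous.rpow_const fun _ => Or.inr hq0.le) ?_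
      (fun t => Real.rpow_nonneg (hnonneg t) q) ?_
    · exact φ.hasCompactSupport.comp_left (g := fun y : ℝ => y ^ q) (Real.zero_rpow hq0.ne')
    · rw [φ.one_of_mem_closedBall (by simp [φ.rIn_pos.le])]
      simp
  set c₁ := ∫ t, (deriv φ t ^ 2 + φ t ^ 2)
  set c := ∫ t, φ t ^ q
  have hc₁ : 0 ≤ c₁ := integral_nonneg fun t => by positivity
  have hpos : 0 < (2 * Real.pi * c) ^ (2 / q) := by positivity
  refine ⟨2 * Real.pi * c₁ / (2 * Real.pi * c) ^ (2 / q), by positivity, fun Φ hΦ S _ h => ?_⟩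
  set d := distToInt Φ with hd
  have hd0 : 0 < d := abs_pos.mpr (sub_ne_zero.mpr (hΦ _))
  have key := h _ (isTestFun_vortex hφ hsupp hd0 (round Φ))
  rw [magEnergy_vortex (hφ.differentiable (by simp)) Φ (round Φ) hd0
      (by rw [hd, distToInt, sq_abs]),
    integral_norm_vortex_rpow hnonneg hd0, div_mul_eq_mul_div,
    Real.div_rpow (by positivity) hd0.le] at key
  have hdq : 0 < d ^ (2 / q) := by positivity
  rw [Real.rpow_add hd0, Real.rpow_one, div_mul_eq_mul_div, le_div_iff₀ hpos]
  rw [mul_div_assoc', div_le_iff₀ hdq] at key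
  linarith
end
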